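/- arXiv:1905.05527 — 2 statements merged into one kernel-verified Lean document; each statement's English description precedes it below -/
import Mathlib

section
/- Fix a real number c and an integer r ≥ 1. The map φ_EC : D → ℝ defined by φ_EC(f) = sup_{t∈[0,1]} { f(t) − c t − (r+1)·J_r^t(f) + r·J_{r+1}^t(f) } is Lipschitz continuous with respect to the Skorokhod J1 metric with Lipschitz constant at most 1 + |c| + 4r² + 4r: for all càdlàg f, g : [0,1] → ℝ, |φ_EC(f) − φ_EC(g)| ≤ (1 + |c| + 4r² + 4r)·d(f,g). -/
open MeasureTheory Filter Set Polynomial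

noncomputable section

/-- Jump of `f` at `s`, with the convention `f(0⁻) = f(0)` (so the jump at `0` is `0`). -/
def jumpAt (f : ℝ → ℝ) (s : ℝ) : ℝ :=
  if s = 0 then 0 else f s - Function.leftLim f s

/-- `J m t f`: supremum over `m`-tuples of pairwise distinct points of `[0,t]` of the
sum of the jumps of `f` at these points (`J m 0 f = 0`). -/
def J (m : ℕ) (t : ℝ) (f : ℝ → ℝ) : ℝ :=
  ⨆ s : { s : Fin m → ℝ // (∀ i, s i ∈ Set.Icc 0 t) ∧ Function.Injective s },
    ∑ i, jumpAt f (s.val i)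

/-- `f` is càdlàg on `[0,1]`: right-continuous, with left limits. -/
def Cadlag (f : ℝ → ℝ) : Prop :=
  (∀ x ∈ Set.Icc (0:ℝ) 1, ContinuousWithinAt f (Set.Ici x) x) ∧
  (∀ x ∈ Set.Ioc (0:ℝ) 1, ∃ l, Filter.Tendsto f (nhdsWithin x (Set.Iio x)) (nhds l))

/-- A strictly increasing continuous bijection of `[0,1]` onto itself. -/
def TimeChange (l : ℝ → ℝ) : Prop :=
  StrictMonoOn l (Set.Icc 0 1) ∧ ContinuousOn l (Set.Icc 0 1) ∧
    Set.BijOn l (Set.Icc 0 1) (Set.Icc 0 1)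

/-- Uniform (sup) norm on `[0,1]`. -/
def supIcc (f : ℝ → ℝ) : ℝ := ⨆ x : Set.Icc (0:ℝ) 1, |f x.val|

/-- The Skorokhod J1 metric on càdlàg functions on `[0,1]`. -/
def skorokhodDist (f g : ℝ → ℝ) : ℝ :=
  ⨅ l : { l : ℝ → ℝ // TimeChange l },
    max (supIcc fun x => l.val x - x) (supIcc fun x => f x - g (l.val x))

/-- The LCR functional `φ_LCR(f) = sup_{t∈[0,1]} { f(t) − c t − J_r^t(f) }`. -/
def phiLCR (c : ℝ) (r : ℕ) (f : ℝ → ℝ) : ℝ :=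
  ⨆ t : Set.Icc (0:ℝ) 1, (f t.val - c * t.val - J r t.val f)

/-- The ECOMOR functional
`φ_EC(f) = sup_{t∈[0,1]} { f(t) − c t − (r+1)·J_r^t(f) + r·J_{r+1}^t(f) }`. -/
def phiEC (c : ℝ) (r : ℕ) (f : ℝ → ℝ) : ℝ :=
  ⨆ t : Set.Icc (0:ℝ) 1,
    (f t.val - c * t.val - ((r:ℝ) + 1) * J r t.val f + (r:ℝ) * J (r+1) t.val f)

/-- The step function `x ↦ ∑ i, y i · 1_{[τ i, 1]}(x)`, viewed as a function on `ℝ`. -/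
def stepFun {k : ℕ} (y τ : Fin k → ℝ) : ℝ → ℝ :=
  fun x => ∑ i, if τ i ≤ x then y i else 0

/-- Nondecreasing step functions vanishing at the origin with at most `j` steps. -/
def stepSet (j : ℕ) : Set (ℝ → ℝ) :=
  { f | ∃ k : ℕ, k ≤ j ∧ ∃ y τ : Fin k → ℝ,
      (∀ i, 0 < y i) ∧ (∀ i, τ i ∈ Set.Ioo (0:ℝ) 1) ∧ Function.Injective τ ∧
      f = stepFun y τ }

/-- Skorokhod distance from a function to a set of functions. -/
def distToSet (f : ℝ → ℝ) (A : Set (ℝ → ℝ)) : ℝ := ⨅ g : A, skorokhodDist f g.val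

/-- The Gauss hypergeometric function `₂F₁(b,e;d;z)`. -/
def hyp2F1 (b e d z : ℝ) : ℝ :=
  ∑' k : ℕ, ((ascPochhammer ℝ k).eval b * (ascPochhammer ℝ k).eval e /
    (ascPochhammer ℝ k).eval d) * z ^ k / (k.factorial : ℝ)

end

open Topology in
/-- A càdlàg function is bounded on `[0,1]`. -/
theorem Cadlag.exists_abs_le {f : ℝ → ℝ} (hf : Cadlag f) :
    ∃ C, ∀ x ∈ Set.Icc (0:ℝ) 1, |f x| ≤ C := by
  refine isCompact_Icc.induction_on (p := fun s => ∃ C, ∀ x ∈ s, |f x| ≤ C) ⟨0, by simp⟩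
    (fun s t hst ⟨C, hC⟩ => ⟨C, fun x hx => hC x (hst hx)⟩) ?_ ?_
  · rintro s t ⟨C, hC⟩ ⟨D, hD⟩
    exact ⟨max C D, fun x hx => hx.elim (fun h => (hC x h).trans (le_max_left _ _))
      fun h => (hD x h).trans (le_max_right _ _)⟩
  · intro x hx
    have key : ∀ {a : ℝ} {F : Filter ℝ}, Tendsto f F (𝓝 a) → ∀ᶠ y in F, |f y| ≤ |a| + 1 :=
      fun h => (h.abs.eventually (gt_mem_nhds (lt_add_one _))).mono fun _ => le_of_lt
    have hR := key (hf.1 x hx)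
    rcases hx.1.eq_or_lt with rfl | h0
    · exact ⟨_, nhdsWithin_mono _ Set.Icc_subset_Ici_self hR, |f 0| + 1, fun _ h => h⟩
    · obtain ⟨l, hl⟩ := hf.2 x ⟨h0, hx.2⟩
      have hL := key hl
      refine ⟨{y | |f y| ≤ max (|l| + 1) (|f x| + 1)}, ?_, _, fun _ h => h⟩
      refine mem_nhdsWithin_of_mem_nhds ?_
      rw [← nhdsLT_sup_nhdsGE]
      exact ⟨hL.mono fun _ h => h.trans (le_max_left _ _),
        hR.mono fun _ h => h.trans (le_max_right _ _)⟩

open Topology in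
theorem Cadlag.tendsto_leftLim {f : ℝ → ℝ} (hf : Cadlag f) {x : ℝ} (hx : x ∈ Set.Ioc (0:ℝ) 1) :
    Tendsto f (𝓝[<] x) (𝓝 (Function.leftLim f x)) :=
  tendsto_leftLim_of_tendsto (hf.2 x hx)

/-- The jumps of a càdlàg function on `[0,1]` are uniformly bounded. -/
theorem Cadlag.exists_abs_jumpAt_le {f : ℝ → ℝ} (hf : Cadlag f) :
    ∃ C, ∀ x ∈ Set.Icc (0:ℝ) 1, |jumpAt f x| ≤ C := by
  obtain ⟨C, hC⟩ := hf.exists_abs_le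
  have hC0 : 0 ≤ C := (abs_nonneg _).trans (hC 0 (by simp))
  refine ⟨C + C, fun x hx => ?_⟩
  unfold jumpAt
  split_ifs with h0
  · simpa using hC0
  have hx0 : 0 < x := lt_of_le_of_ne hx.1 (Ne.symm h0)
  have hl : |Function.leftLim f x| ≤ C := by
    refine le_of_tendsto (hf.tendsto_leftLim ⟨hx0, hx.2⟩).abs ?_
    filter_upwards [Ioo_mem_nhdsLT hx0] with y hy
    exact hC y ⟨hy.1.le, hy.2.le.trans hx.2⟩
  exact (abs_sub _ _).trans (add_le_add (hC x hx) hl)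

theorem J_zero_right (m : ℕ) (f : ℝ → ℝ) : J m 0 f = 0 := by
  have h : ∀ s : { s : Fin m → ℝ // (∀ i, s i ∈ Set.Icc (0:ℝ) 0) ∧ Function.Injective s },
      ∑ i, jumpAt f (s.val i) = 0 := fun s => by
    refine Finset.sum_eq_zero fun i _ => ?_
    have : s.val i = 0 := by simpa using s.2.1 i
    simp [this, jumpAt]
  simp [J, h]

theorem nonempty_tuples (m : ℕ) {t : ℝ} (ht : 0 < t) :
    Nonempty { s : Fin m → ℝ // (∀ i, s i ∈ Set.Icc 0 t) ∧ Function.Injective s } := by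
  have : Infinite (Set.Icc (0:ℝ) t) := (Set.Icc_infinite ht).to_subtype
  let e : Fin m ↪ Set.Icc (0:ℝ) t := Fin.valEmbedding.trans (Infinite.natEmbedding _)
  exact ⟨fun i => (e i).1, fun i => (e i).2, fun i j h => e.injective (Subtype.ext h)⟩

theorem abs_sum_jumpAt_le {f : ℝ → ℝ} {C : ℝ} (hC : ∀ x ∈ Set.Icc (0:ℝ) 1, |jumpAt f x| ≤ C)
    {m : ℕ} {t : ℝ} (ht : t ≤ 1) {s : Fin m → ℝ} (hs : ∀ i, s i ∈ Set.Icc 0 t) :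
    |∑ i, jumpAt f (s i)| ≤ m * C := by
  refine (Finset.abs_sum_le_sum_abs _ _).trans ?_
  refine (Finset.sum_le_card_nsmul _ _ C fun i _ =>
    hC _ ⟨(hs i).1, (hs i).2.trans ht⟩).trans ?_
  simp

theorem abs_J_le {f : ℝ → ℝ} {C : ℝ} (hC : ∀ x ∈ Set.Icc (0:ℝ) 1, |jumpAt f x| ≤ C)
    (m : ℕ) {t : ℝ} (ht : t ∈ Set.Icc (0:ℝ) 1) : |J m t f| ≤ m * C := by
  have hC0 : 0 ≤ C := (abs_nonneg _).trans (hC 0 (by simp))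
  rcases ht.1.eq_or_lt with rfl | h0
  · rw [J_zero_right, abs_zero]; positivity
  obtain ⟨s⟩ := nonempty_tuples m h0
  have hb := fun s : { s : Fin m → ℝ // (∀ i, s i ∈ Set.Icc 0 t) ∧ Function.Injective s } =>
    abs_le.1 (abs_sum_jumpAt_le hC ht.2 s.2.1)
  have : Nonempty _ := ⟨s⟩
  exact abs_le.2 ⟨(hb s).1.trans (le_ciSup ⟨_, Set.forall_mem_range.2 fun s => (hb s).2⟩ s),
    ciSup_le fun s => (hb s).2⟩

/-- Transporting tuples along an injection that changes jumps by at most `K`. -/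
theorem J_le_add {f g : ℝ → ℝ} (hg : Cadlag g) (m : ℕ) {t u K : ℝ} (ht : 0 < t) (hu : u ≤ 1)
    {τ : ℝ → ℝ} (hτ : Set.MapsTo τ (Set.Icc 0 t) (Set.Icc 0 u)) (hinj : Set.InjOn τ (Set.Icc 0 t))
    (hK : ∀ s ∈ Set.Icc 0 t, jumpAt f s ≤ jumpAt g (τ s) + K) :
    J m t f ≤ J m u g + m * K := by
  obtain ⟨C, hC⟩ := hg.exists_abs_jumpAt_le
  have := nonempty_tuples m ht
  refine ciSup_le fun s => ?_
  have hle : ∑ i, jumpAt g (τ (s.val i)) ≤ J m u g :=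
    le_ciSup (f := fun s : { s : Fin m → ℝ // (∀ i, s i ∈ Set.Icc 0 u) ∧ Function.Injective s } =>
        ∑ i, jumpAt g (s.val i))
      ⟨_, Set.forall_mem_range.2 fun s => (abs_le.1 (abs_sum_jumpAt_le hC hu s.2.1)).2⟩
      ⟨fun i => τ (s.val i), fun i => hτ (s.2.1 i),
        fun i j h => s.2.2 (hinj (s.2.1 i) (s.2.1 j) h)⟩
  calc ∑ i, jumpAt f (s.val i) ≤ ∑ i, (jumpAt g (τ (s.val i)) + K) :=
        Finset.sum_le_sum fun i _ => hK _ (s.2.1 i)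
    _ = ∑ i, jumpAt g (τ (s.val i)) + m * K := by simp [Finset.sum_add_distrib]
    _ ≤ _ := by gcongr

theorem TimeChange.map_zero {l : ℝ → ℝ} (hl : TimeChange l) : l 0 = 0 := by
  obtain ⟨y, hy, hy0⟩ := hl.2.2.surjOn (Set.left_mem_Icc.2 zero_le_one)
  have h0 : (0:ℝ) ∈ Set.Icc (0:ℝ) 1 := by simp
  exact le_antisymm (hy0 ▸ hl.1.monotoneOn h0 hy hy.1) (hl.2.2.mapsTo h0).1

theorem TimeChange.map_pos {l : ℝ → ℝ} (hl : TimeChange l) {t : ℝ} (ht : t ∈ Set.Ioc (0:ℝ) 1) :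
    0 < l t :=
  hl.map_zero ▸ hl.1 (by simp) ⟨ht.1.le, ht.2⟩ ht.1

theorem timeChange_id : TimeChange id :=
  ⟨strictMonoOn_id, continuousOn_id, Set.bijOn_id _⟩

/-- Jumps of `f` and `g` matched by a time change differ by at most twice the uniform distance. -/
theorem abs_jumpAt_sub_le {f g l : ℝ → ℝ} (hf : Cadlag f) (hg : Cadlag g) (hl : TimeChange l)
    {δ : ℝ} (hδ : ∀ x ∈ Set.Icc (0:ℝ) 1, |f x - g (l x)| ≤ δ) {s : ℝ}
    (hs : s ∈ Set.Icc (0:ℝ) 1) : |jumpAt f s - jumpAt g (l s)| ≤ 2 * δ := by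
  rcases hs.1.eq_or_lt with rfl | h0
  · have := (abs_nonneg _).trans (hδ 0 hs)
    simpa [hl.map_zero, jumpAt] using this
  have hls := hl.map_pos ⟨h0, hs.2⟩
  have hmem : ∀ᶠ y in nhdsWithin s (Set.Iio s), y ∈ Set.Icc (0:ℝ) 1 ∧ y < s := by
    filter_upwards [Ioo_mem_nhdsLT h0] with y hy
    exact ⟨⟨hy.1.le, hy.2.le.trans hs.2⟩, hy.2⟩
  have hlt : Tendsto l (nhdsWithin s (Set.Iio s)) (nhdsWithin (l s) (Set.Iio (l s))) := by
    refine tendsto_nhdsWithin_iff.2 ⟨(hl.2.1 s hs).mono_left ?_, ?_⟩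
    · exact nhdsWithin_le_iff.2 (hmem.mono fun _ h => h.1)
    · exact hmem.mono fun y h => hl.1 h.1 hs h.2
  have hlim : |Function.leftLim f s - Function.leftLim g (l s)| ≤ δ :=
    le_of_tendsto ((hf.tendsto_leftLim ⟨h0, hs.2⟩).sub
      ((hg.tendsto_leftLim ⟨hls, (hl.2.2.mapsTo hs).2⟩).comp hlt)).abs
      (hmem.mono fun y h => hδ y h.1)
  have h1 := abs_le.1 (hδ s hs)
  have h2 := abs_le.1 hlim
  rw [jumpAt, jumpAt, if_neg h0.ne', if_neg hls.ne', abs_le]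
  constructor <;> linarith

/-- `J` is stable under time changes. -/
theorem abs_J_sub_le {f g l : ℝ → ℝ} (hf : Cadlag f) (hg : Cadlag g) (hl : TimeChange l)
    {δ : ℝ} (hδ : ∀ x ∈ Set.Icc (0:ℝ) 1, |f x - g (l x)| ≤ δ) (m : ℕ) {t : ℝ}
    (ht : t ∈ Set.Icc (0:ℝ) 1) : |J m t f - J m (l t) g| ≤ m * (2 * δ) := by
  rcases ht.1.eq_or_lt with rfl | h0
  · have := (abs_nonneg _).trans (hδ 0 ht)
    rw [hl.map_zero, J_zero_right, J_zero_right, sub_zero, abs_zero]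
    positivity
  have hlt := hl.2.2.mapsTo ht
  have hsub : Set.Icc 0 t ⊆ Set.Icc (0:ℝ) 1 := Set.Icc_subset_Icc_right ht.2
  have hsub' : Set.Icc 0 (l t) ⊆ Set.Icc (0:ℝ) 1 := Set.Icc_subset_Icc_right hlt.2
  have hjump := fun s hs => abs_le.1 (abs_jumpAt_sub_le hf hg hl hδ (s := s) hs)
  have h1 : J m t f ≤ J m (l t) g + m * (2 * δ) := by
    refine J_le_add hg m h0 hlt.2 (τ := l) (fun s hs => ?_) (hl.2.2.injOn.mono hsub)
      fun s hs => ?_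
    · exact ⟨(hl.2.2.mapsTo (hsub hs)).1, hl.1.monotoneOn (hsub hs) ht hs.2⟩
    · linarith [(hjump s (hsub hs)).2]
  have hmaps := hl.2.2.surjOn.mapsTo_invFunOn
  have hinv := hl.2.2.surjOn.rightInvOn_invFunOn
  have h2 : J m (l t) g ≤ J m t f + m * (2 * δ) := by
    refine J_le_add hf m (hl.map_pos ⟨h0, ht.2⟩) ht.2
      (τ := Function.invFunOn l (Set.Icc 0 1)) (fun s hs => ?_)
      (hinv.injOn.mono hsub') fun s hs => ?_
    · refine ⟨(hmaps (hsub' hs)).1, (hl.1.le_iff_le (hmaps (hsub' hs)) ht).1 ?_⟩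
      rw [hinv (hsub' hs)]
      exact hs.2
    · have := (hjump _ (hmaps (hsub' hs))).1
      rw [hinv (hsub' hs)] at this
      linarith
  rw [abs_le]
  constructor <;> linarith

theorem bddAbove_phiEC (c : ℝ) (r : ℕ) {f : ℝ → ℝ} (hf : Cadlag f) :
    BddAbove (Set.range fun t : Set.Icc (0:ℝ) 1 =>
      f t.val - c * t.val - ((r:ℝ) + 1) * J r t.val f + (r:ℝ) * J (r+1) t.val f) := by
  obtain ⟨C, hC⟩ := hf.exists_abs_le
  obtain ⟨D, hD⟩ := hf.exists_abs_jumpAt_le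
  refine ⟨C + |c| + ((r:ℝ) + 1) * (r * D) + r * (((r + 1 : ℕ) : ℝ) * D),
    Set.forall_mem_range.2 fun t => ?_⟩
  have h1 := (abs_le.1 (hC t t.2)).2
  have h2 : -(c * t.val) ≤ |c| :=
    (neg_le_abs _).trans (by rw [abs_mul, abs_of_nonneg t.2.1]; nlinarith [abs_nonneg c, t.2.2])
  have h3 := mul_le_mul_of_nonneg_left (abs_le.1 (abs_J_le hD r t.2)).1
    (by positivity : (0:ℝ) ≤ (r:ℝ) + 1)
  have h4 := mul_le_mul_of_nonneg_left (abs_le.1 (abs_J_le hD (r + 1) t.2)).2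
    (by positivity : (0:ℝ) ≤ (r:ℝ))
  linarith

theorem abs_le_supIcc {h : ℝ → ℝ} {C : ℝ} (hC : ∀ x ∈ Set.Icc (0:ℝ) 1, |h x| ≤ C) {x : ℝ}
    (hx : x ∈ Set.Icc (0:ℝ) 1) : |h x| ≤ supIcc h :=
  le_ciSup (f := fun x : Set.Icc (0:ℝ) 1 => |h x.val|)
    ⟨C, Set.forall_mem_range.2 fun y => hC y y.2⟩ ⟨x, hx⟩

/-- the ECOMOR functional is Lipschitz with constant at most
`1 + |c| + 4r² + 4r` w.r.t. the Skorokhod J1 metric. -/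
theorem phiEC_lipschitz (c : ℝ) (r : ℕ) (hr : 1 ≤ r)
    (f g : ℝ → ℝ) (hf : Cadlag f) (hg : Cadlag g) :
    |phiEC c r f - phiEC c r g| ≤
      (1 + |c| + 4 * (r : ℝ) ^ 2 + 4 * (r : ℝ)) * skorokhodDist f g := by
  have : Nonempty { l : ℝ → ℝ // TimeChange l } := ⟨⟨id, timeChange_id⟩⟩
  rw [skorokhodDist, Real.mul_iInf_of_nonneg (by positivity)]
  refine le_ciInf fun ⟨l, hl⟩ => ?_
  set M := max (supIcc fun x => l x - x) (supIcc fun x => f x - g (l x))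
  have hε : ∀ x ∈ Set.Icc (0:ℝ) 1, |l x - x| ≤ M := fun x hx =>
    (abs_le_supIcc (h := fun x => l x - x) (C := 1) (fun y hy => by
      have := hl.2.2.mapsTo hy
      rw [abs_le]
      constructor <;> linarith [this.1, this.2, hy.1, hy.2]) hx).trans (le_max_left _ _)
  obtain ⟨A, hA⟩ := hf.exists_abs_le
  obtain ⟨B, hB⟩ := hg.exists_abs_le
  have hδ : ∀ x ∈ Set.Icc (0:ℝ) 1, |f x - g (l x)| ≤ M := fun x hx =>
    (abs_le_supIcc (h := fun x => f x - g (l x)) (C := A + B) (fun y hy =>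
      (abs_sub _ _).trans (add_le_add (hA y hy) (hB _ (hl.2.2.mapsTo hy)))) hx).trans
      (le_max_right _ _)
  have key : ∀ t ∈ Set.Icc (0:ℝ) 1,
      |(f t - c * t - ((r:ℝ) + 1) * J r t f + (r:ℝ) * J (r+1) t f) -
        (g (l t) - c * l t - ((r:ℝ) + 1) * J r (l t) g + (r:ℝ) * J (r+1) (l t) g)| ≤
      (1 + |c| + 4 * (r : ℝ) ^ 2 + 4 * (r : ℝ)) * M := by
    intro t ht
    have h1 := abs_le.1 (hδ t ht)
    have h2 : |c * (l t - t)| ≤ |c| * M := by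
      rw [abs_mul]
      exact mul_le_mul_of_nonneg_left (hε t ht) (abs_nonneg c)
    have h3 : |((r:ℝ) + 1) * (J r t f - J r (l t) g)| ≤ ((r:ℝ) + 1) * (r * (2 * M)) := by
      rw [abs_mul, abs_of_nonneg (by positivity)]
      exact mul_le_mul_of_nonneg_left (abs_J_sub_le hf hg hl hδ r ht) (by positivity)
    have h4 : |(r:ℝ) * (J (r+1) t f - J (r+1) (l t) g)| ≤ r * (((r + 1 : ℕ) : ℝ) * (2 * M)) := by
      rw [abs_mul, abs_of_nonneg (by positivity)]
      exact mul_le_mul_of_nonneg_left (abs_J_sub_le hf hg hl hδ (r + 1) ht) (by positivity)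
    push_cast at h4
    rw [abs_le] at h2 h3 h4 ⊢
    constructor <;> linarith [h1.1, h1.2, h2.1, h2.2, h3.1, h3.2, h4.1, h4.2]
  have : Nonempty (Set.Icc (0:ℝ) 1) := ⟨⟨0, by simp⟩⟩
  rw [abs_sub_le_iff, sub_le_iff_le_add, sub_le_iff_le_add]
  constructor
  · refine ciSup_le fun t => ?_
    have h := le_ciSup (bddAbove_phiEC c r hg) ⟨l t, hl.2.2.mapsTo t.2⟩
    rw [← phiEC] at h
    linarith [(abs_le.1 (key t t.2)).2]
  · refine ciSup_le fun ⟨u, hu⟩ => ?_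
    obtain ⟨t, ht, rfl⟩ := hl.2.2.surjOn hu
    have h := le_ciSup (bddAbove_phiEC c r hf) ⟨t, ht⟩
    rw [← phiEC] at h
    linarith [(abs_le.1 (key t ht)).1]
end

section
/- Fix a real number c, a real number a with a > 0 and a + c > 0, and an integer r ≥ 1. Let A_LCR = { f ∈ D : φ_LCR(f) ≥ a }, where φ_LCR(f) = sup_{t∈[0,1]} { f(t) − c t − J_r^t(f) }. Then the infimum, over all nondecreasing step functions f vanishing at the origin (with all step times in (0,1), pairwise distinct, and strictly positive step sizes) belonging to A_LCR, of the number of steps of f, equals r+1. -/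
open MeasureTheory Filter Set Polynomial

lemma jumpAt_stepFun {k : ℕ} (y τ : Fin k → ℝ) (hτ : ∀ i, 0 < τ i) (s : ℝ) :
    jumpAt (stepFun y τ) s = ∑ i, if τ i = s then y i else 0 := by
  unfold jumpAt
  split_ifs with h
  · subst h
    exact (Finset.sum_eq_zero fun i _ => if_neg (hτ i).ne').symm
  · have hlim : Tendsto (stepFun y τ) (nhdsWithin s (Set.Iio s))
        (nhds (∑ i, if τ i < s then y i else 0)) := by
      refine tendsto_finsetSum _ fun i _ => ?_
      refine tendsto_const_nhds.congr' ?_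
      by_cases hi : τ i < s
      · filter_upwards [mem_nhdsWithin_of_mem_nhds (Ioi_mem_nhds hi)] with x hx
        rw [if_pos hi, if_pos (le_of_lt hx)]
      · filter_upwards [self_mem_nhdsWithin] with x hx
        rw [if_neg hi, if_neg (not_le.2 (lt_of_lt_of_le hx (not_lt.1 hi)))]
    rw [leftLim_eq_of_tendsto hlim, stepFun, ← Finset.sum_sub_distrib]
    refine Finset.sum_congr rfl fun i _ => ?_
    rcases lt_trichotomy (τ i) s with hi | hi | hi
    · simp [hi, hi.le, hi.ne]
    · simp [hi]
    · simp [hi.not_ge, hi.not_gt, hi.ne']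

lemma jumpAt_stepFun_nonneg {k : ℕ} {y τ : Fin k → ℝ} (hy : ∀ i, 0 < y i)
    (hτ : ∀ i, 0 < τ i) (s : ℝ) : 0 ≤ jumpAt (stepFun y τ) s := by
  rw [jumpAt_stepFun y τ hτ]
  exact Finset.sum_nonneg fun i _ => by split_ifs <;> simp [(hy i).le]

lemma jumpAt_stepFun_le {k : ℕ} {y τ : Fin k → ℝ} (hy : ∀ i, 0 < y i)
    (hτ : ∀ i, 0 < τ i) (s : ℝ) : jumpAt (stepFun y τ) s ≤ ∑ i, y i := by
  rw [jumpAt_stepFun y τ hτ]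
  exact Finset.sum_le_sum fun i _ => by split_ifs <;> simp [(hy i).le]

lemma J_stepFun_nonneg {k : ℕ} {y τ : Fin k → ℝ} (hy : ∀ i, 0 < y i)
    (hτ : ∀ i, 0 < τ i) (m : ℕ) (t : ℝ) : 0 ≤ J m t (stepFun y τ) :=
  Real.iSup_nonneg fun _ => Finset.sum_nonneg fun _ _ => jumpAt_stepFun_nonneg hy hτ _

/-- The `r` largest jumps account for the whole of a step function with at most `r` steps. -/
lemma stepFun_le_J {k r : ℕ} {y τ : Fin k → ℝ} (hkr : k ≤ r) (hy : ∀ i, 0 < y i)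
    (hτ : ∀ i, 0 < τ i) {t : ℝ} (ht : 0 ≤ t) : stepFun y τ t ≤ J r t (stepFun y τ) := by
  rcases ht.eq_or_lt with rfl | ht
  · have : stepFun y τ 0 = 0 := Finset.sum_eq_zero fun i _ => if_neg (hτ i).not_ge
    rw [this]
    exact J_stepFun_nonneg hy hτ r 0
  · have hcard : ((Finset.univ.filter fun i => τ i ≤ t).image τ).card ≤ r :=
      Finset.card_image_le.trans ((Finset.card_filter_le _ _).trans (by simpa using hkr))
    obtain ⟨S, hTS, hSt, hSr⟩ : ∃ S : Finset ℝ,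
        (Finset.univ.filter fun i => τ i ≤ t).image τ ⊆ S ∧ (S : Set ℝ) ⊆ Icc 0 t ∧
          S.card = r := by
      set T := (Finset.univ.filter fun i => τ i ≤ t).image τ
      obtain ⟨U, hU, hUc⟩ :=
        ((Set.Icc_infinite ht).sdiff T.finite_toSet).exists_subset_card_eq (r - T.card)
      have hdisj : Disjoint T U :=
        Finset.disjoint_left.2 fun x hxT hxU => (hU hxU).2 hxT
      refine ⟨T ∪ U, Finset.subset_union_left, ?_, ?_⟩
      · intro x hx
        rcases Finset.mem_union.1 hx with hx | hx
        · obtain ⟨i, hi, rfl⟩ := Finset.mem_image.1 hx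
          exact ⟨(hτ i).le, (Finset.mem_filter.1 hi).2⟩
        · exact (hU hx).1
      · rw [Finset.card_union_of_disjoint hdisj, hUc]
        omega
    have hbdd : BddAbove (Set.range fun s : { s : Fin r → ℝ //
        (∀ i, s i ∈ Set.Icc 0 t) ∧ Function.Injective s } =>
          ∑ i, jumpAt (stepFun y τ) (s.val i)) := by
      refine ⟨∑ _i : Fin r, ∑ i, y i, ?_⟩
      rintro _ ⟨s, rfl⟩
      exact Finset.sum_le_sum fun i _ => jumpAt_stepFun_le hy hτ _
    refine le_trans ?_ (le_ciSup hbdd ⟨S.orderEmbOfFin hSr,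
      fun i => hSt (S.orderEmbOfFin_mem hSr i), (S.orderEmbOfFin hSr).injective⟩)
    have hsum : ∑ i, jumpAt (stepFun y τ) (S.orderEmbOfFin hSr i) =
        ∑ x ∈ S, jumpAt (stepFun y τ) x := by
      conv_rhs => rw [← S.map_orderEmbOfFin_univ hSr]
      rw [Finset.sum_map]
      rfl
    change _ ≤ ∑ i, jumpAt (stepFun y τ) (S.orderEmbOfFin hSr i)
    rw [hsum]
    simp_rw [jumpAt_stepFun y τ hτ]
    rw [Finset.sum_comm]
    refine Finset.sum_le_sum fun i _ => ?_
    rw [Finset.sum_ite_eq]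
    by_cases hi : τ i ≤ t
    · rw [if_pos hi, if_pos (hTS (Finset.mem_image_of_mem τ (by simpa using hi)))]
    · rw [if_neg hi]
      split_ifs <;> simp [(hy i).le]

lemma phiLCR_stepFun_lt {k r : ℕ} {c a : ℝ} {y τ : Fin k → ℝ} (ha : 0 < a) (hac : 0 < a + c)
    (hkr : k ≤ r) (hy : ∀ i, 0 < y i) (hτ : ∀ i, 0 < τ i) :
    phiLCR c r (stepFun y τ) < a := by
  refine lt_of_le_of_lt (b := max 0 (-c)) ?_ (max_lt ha (by linarith))
  have : Nonempty (Set.Icc (0 : ℝ) 1) := ⟨⟨0, by simp⟩⟩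
  refine ciSup_le fun t => ?_
  have h := stepFun_le_J hkr hy hτ t.2.1
  rcases le_total 0 c with hc | hc
  · have := mul_nonneg hc t.2.1
    linarith [le_max_left 0 (-c)]
  · nlinarith [le_max_right 0 (-c), t.2.2]

lemma bddAbove_range_phiLCR_stepFun {k : ℕ} {y τ : Fin k → ℝ} (c : ℝ) (r : ℕ)
    (hy : ∀ i, 0 < y i) (hτ : ∀ i, 0 < τ i) :
    BddAbove (Set.range fun t : Set.Icc (0 : ℝ) 1 =>
      stepFun y τ t.val - c * t.val - J r t.val (stepFun y τ)) := by
  refine ⟨∑ i, y i + |c|, ?_⟩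
  rintro _ ⟨t, rfl⟩
  have h1 : stepFun y τ t.val ≤ ∑ i, y i :=
    Finset.sum_le_sum fun i _ => by split_ifs <;> simp [(hy i).le]
  have h2 := J_stepFun_nonneg hy hτ r t.val
  have h3 : -(c * t.val) ≤ |c| := by
    refine (neg_le_abs _).trans ?_
    rw [abs_mul, abs_of_nonneg t.2.1]
    exact mul_le_of_le_one_right (abs_nonneg c) t.2.2
  dsimp only
  linarith

lemma J_stepFun_const_le {k : ℕ} {b : ℝ} {τ : Fin k → ℝ} (hb : 0 ≤ b) (hτ : ∀ i, 0 < τ i)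
    (hinj : Function.Injective τ) (m : ℕ) (t : ℝ) :
    J m t (stepFun (fun _ => b) τ) ≤ m * b := by
  refine Real.iSup_le (fun s => ?_) (by positivity)
  have hjump : ∀ x, jumpAt (stepFun (fun _ => b) τ) x ≤ b := by
    intro x
    rw [jumpAt_stepFun _ τ hτ]
    by_cases hx : ∃ i, τ i = x
    · obtain ⟨i, rfl⟩ := hx
      simp [hinj.eq_iff]
    · push Not at hx
      simpa [hx] using hb
  calc ∑ i, jumpAt (stepFun (fun _ => b) τ) (s.val i) ≤ ∑ _i : Fin m, b :=
        Finset.sum_le_sum fun i _ => hjump _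
    _ = m * b := by simp

/-- the minimal number of steps of a nondecreasing step function vanishing
at the origin that belongs to `A_LCR = {φ_LCR ≥ a}` is `r+1`. -/
theorem rate_function_LCR (c a : ℝ) (ha : 0 < a) (hac : 0 < a + c)
    (r : ℕ) (hr : 1 ≤ r) :
    sInf { j : ℕ | ∃ y τ : Fin j → ℝ,
        (∀ i, 0 < y i) ∧ (∀ i, τ i ∈ Set.Ioo (0:ℝ) 1) ∧ Function.Injective τ ∧
        a ≤ phiLCR c r (stepFun y τ) } = r + 1 := by
  refine IsLeast.csInf_eq ⟨?_, ?_⟩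
  · obtain ⟨S, hS, hSc⟩ := (Set.Ioo_infinite (zero_lt_one' ℝ)).exists_subset_card_eq (r + 1)
    have hτ : ∀ i, S.orderEmbOfFin hSc i ∈ Set.Ioo (0 : ℝ) 1 :=
      fun i => hS (S.orderEmbOfFin_mem hSc i)
    have hinj : Function.Injective (S.orderEmbOfFin hSc) := (S.orderEmbOfFin hSc).injective
    refine ⟨fun _ => a + c, S.orderEmbOfFin hSc, fun _ => hac, hτ, hinj, ?_⟩
    refine le_trans ?_ (le_ciSup (bddAbove_range_phiLCR_stepFun c r (fun _ => hac)
      fun i => (hτ i).1) ⟨1, by simp⟩)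
    have hJ := J_stepFun_const_le hac.le (fun i => (hτ i).1) hinj r 1
    have hf : stepFun (fun _ => a + c) (S.orderEmbOfFin hSc) 1 = (r + 1) * (a + c) := by
      simp [stepFun, (hτ _).2.le]
      ring
    dsimp only
    rw [hf]
    linarith
  · rintro j ⟨y, τ, hy, hτ, -, h⟩
    by_contra hj
    exact (phiLCR_stepFun_lt ha hac (by omega) hy fun i => (hτ i).1).not_ge h
end
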